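/- Let n > 2 be a real number. There exists a constant C < ∞ depending only on n such that for all ε ∈ (0,1) and all r ∈ ℝ one has |log F_ε(r)| ≤ C (G_ε(r) + |r| + 1). -/

import Mathlib

open MeasureTheory

/-- `F_ε(r) = (r² + ε²)^(n/4)` -/
noncomputable def Feps (n ε r : ℝ) : ℝ := (r ^ 2 + ε ^ 2) ^ (n / 4)

/-- `G_ε(r) = ∫_r^∞ ∫_{r'}^∞ (r''² + ε²)^(-n/2) dr'' dr'` -/
noncomputable def Geps (n ε r : ℝ) : ℝ :=
  ∫ r' in Set.Ioi r, ∫ r'' in Set.Ioi r', (r'' ^ 2 + ε ^ 2) ^ (-(n / 2))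

/-- The density `x ↦ (x² + ε²)^(-n/2)` is integrable on `ℝ` for `n > 1`. -/
lemma integrable_sq_add_sq_rpow_neg {n ε : ℝ} (hn : 1 < n) (hε : ε ∈ Set.Ioo (0 : ℝ) 1) :
    Integrable (fun x : ℝ => (x ^ 2 + ε ^ 2) ^ (-(n / 2))) := by
  obtain ⟨h0, h1⟩ := hε
  have h := (integrable_rpow_neg_one_add_norm_sq (E := ℝ) (μ := volume) (r := n)
    (by simpa using hn)).const_mul ((ε ^ 2) ^ (-(n / 2)))
  refine h.mono' (Continuous.aestronglyMeasurable ?_) (Filter.Eventually.of_forall fun x => ?_)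
  · exact Continuous.rpow_const (by fun_prop) fun x => Or.inl (by positivity)
  · rw [Real.norm_of_nonneg (by positivity), Real.norm_eq_abs, sq_abs, neg_div,
      ← Real.mul_rpow (by positivity) (by positivity)]
    refine Real.rpow_le_rpow_of_nonpos (by positivity) ?_ (by linarith)
    nlinarith [sq_nonneg x, mul_nonneg (sq_nonneg x) (by nlinarith : 0 ≤ 1 - ε ^ 2)]

/-- The tail integral of a nonnegative integrable function is antitone. -/
lemma antitone_setIntegral_Ioi {f : ℝ → ℝ} (hf : Integrable f) (h0 : ∀ x, 0 ≤ f x) :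
    Antitone fun a => ∫ x in Set.Ioi a, f x := fun _ _ hab =>
  setIntegral_mono_set hf.integrableOn (Filter.Eventually.of_forall h0)
    (Set.Ioi_subset_Ioi hab).eventuallyLE

/-- The inner integral in the definition of `Geps` is integrable on every half-line. -/
lemma integrableOn_Ioi_tail {n ε : ℝ} (hn : 2 < n) (hε : ε ∈ Set.Ioo (0 : ℝ) 1) (r : ℝ) :
    IntegrableOn (fun r' => ∫ x in Set.Ioi r', (x ^ 2 + ε ^ 2) ^ (-(n / 2))) (Set.Ioi r) := by
  have hf := integrable_sq_add_sq_rpow_neg (by linarith : 1 < n) hε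
  have h0 : ∀ x : ℝ, 0 ≤ (x ^ 2 + ε ^ 2) ^ (-(n / 2)) := fun x => by positivity
  have hanti := antitone_setIntegral_Ioi hf h0
  have htail : IntegrableOn (fun r' => ∫ x in Set.Ioi r', (x ^ 2 + ε ^ 2) ^ (-(n / 2)))
      (Set.Ioi 1) := by
    have hdom := (integrableOn_Ioi_rpow_of_lt (a := -n + 1) (by linarith)
      zero_lt_one).const_mul (n - 1)⁻¹
    refine hdom.mono' hanti.measurable.aestronglyMeasurable ?_
    filter_upwards [ae_restrict_mem measurableSet_Ioi] with a (ha : 1 < a)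
    rw [Real.norm_of_nonneg (integral_nonneg h0)]
    calc ∫ x in Set.Ioi a, (x ^ 2 + ε ^ 2) ^ (-(n / 2))
        ≤ ∫ x in Set.Ioi a, x ^ (-n) := by
          refine setIntegral_mono_on hf.integrableOn
            (integrableOn_Ioi_rpow_of_lt (by linarith) (by linarith)) measurableSet_Ioi
            fun x (hx : a < x) => ?_
          have hx0 : 0 < x := by linarith
          calc (x ^ 2 + ε ^ 2) ^ (-(n / 2)) ≤ (x ^ 2) ^ (-(n / 2)) :=
                Real.rpow_le_rpow_of_nonpos (by positivity) (by nlinarith [sq_nonneg ε])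
                  (by linarith)
            _ = x ^ (-n) := by
                rw [← Real.rpow_natCast_mul hx0.le]
                congr 1
                push_cast
                ring
      _ = (n - 1)⁻¹ * a ^ (-n + 1) := by
          rw [integral_Ioi_rpow_of_lt (by linarith) (by linarith)]
          have : n - 1 ≠ 0 := by linarith
          have : -n + 1 ≠ 0 := by linarith
          field_simp
          ring
  have hcpt : IntegrableOn (fun r' => ∫ x in Set.Ioi r', (x ^ 2 + ε ^ 2) ^ (-(n / 2)))
      (Set.Icc r 1) := (hanti.antitoneOn _).integrableOn_isCompact isCompact_Icc
  refine (hcpt.union htail).mono_set fun x (hx : r < x) => ?_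
  rcases le_or_gt x 1 with h | h
  · exact Or.inl ⟨hx.le, h⟩
  · exact Or.inr h

lemma Geps_nonneg (n ε r : ℝ) : 0 ≤ Geps n ε r :=
  integral_nonneg fun _ => integral_nonneg fun x => by positivity

/-- For `ε ≤ a ≤ 1`, the inner integral at `a` is at least a constant multiple of `a⁻¹`. -/
lemma mul_inv_le_tail {n ε a : ℝ} (hn : 2 < n) (hε : ε ∈ Set.Ioo (0 : ℝ) 1) (hεa : ε ≤ a)
    (ha : a ≤ 1) :
    5 ^ (-(n / 2)) * a⁻¹ ≤ ∫ x in Set.Ioi a, (x ^ 2 + ε ^ 2) ^ (-(n / 2)) := by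
  have hf := integrable_sq_add_sq_rpow_neg (by linarith : 1 < n) hε
  have h0 : ∀ x : ℝ, 0 ≤ (x ^ 2 + ε ^ 2) ^ (-(n / 2)) := fun x => by positivity
  obtain ⟨hε0, -⟩ := hε
  have ha0 : 0 < a := by linarith
  calc (5 : ℝ) ^ (-(n / 2)) * a⁻¹ ≤ a * (5 * a ^ 2) ^ (-(n / 2)) := by
        rw [Real.mul_rpow (by norm_num) (by positivity), ← Real.rpow_natCast_mul ha0.le]
        have h : a⁻¹ ≤ a * a ^ ((2 : ℕ) * (-(n / 2))) := by
          rw [← Real.rpow_one_add' ha0.le (by push_cast; linarith), ← Real.rpow_neg_one]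
          exact Real.rpow_le_rpow_of_exponent_ge ha0 ha (by push_cast; linarith)
        have h5 : (0 : ℝ) ≤ 5 ^ (-(n / 2)) := by positivity
        nlinarith [mul_le_mul_of_nonneg_left h h5]
    _ = ∫ _ in Set.Ioc a (2 * a), (5 * a ^ 2) ^ (-(n / 2)) := by
        rw [setIntegral_const, Real.volume_real_Ioc_of_le (by linarith), smul_eq_mul]
        ring
    _ ≤ ∫ x in Set.Ioc a (2 * a), (x ^ 2 + ε ^ 2) ^ (-(n / 2)) := by
        refine setIntegral_mono_on (by simp) hf.integrableOn
          measurableSet_Ioc fun x hx => ?_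
        refine Real.rpow_le_rpow_of_nonpos (by positivity) ?_ (by linarith)
        nlinarith [hx.1, hx.2]
    _ ≤ ∫ x in Set.Ioi a, (x ^ 2 + ε ^ 2) ^ (-(n / 2)) :=
        setIntegral_mono_set hf.integrableOn (Filter.Eventually.of_forall h0)
          Set.Ioc_subset_Ioi_self.eventuallyLE

/-- `G_ε(r)` diverges at least logarithmically as `|r| + ε → 0`. -/
lemma mul_neg_log_le_Geps {n ε r : ℝ} (hn : 2 < n) (hε : ε ∈ Set.Ioo (0 : ℝ) 1) :
    5 ^ (-(n / 2)) * -Real.log (|r| + ε) ≤ Geps n ε r := by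
  have ha0 : 0 < |r| + ε := add_pos_of_nonneg_of_pos (abs_nonneg r) hε.1
  have hεa : ε ≤ |r| + ε := by linarith [abs_nonneg r]
  have hra : r ≤ |r| + ε := by linarith [le_abs_self r, hε.1]
  generalize |r| + ε = a at *
  have h5 : (0 : ℝ) ≤ 5 ^ (-(n / 2)) := by positivity
  rcases le_or_gt 1 a with h1 | h1
  · exact (mul_nonpos_of_nonneg_of_nonpos h5
      (neg_nonpos.2 (Real.log_nonneg h1))).trans (Geps_nonneg n ε r)
  have hI := integrableOn_Ioi_tail hn hε r
  have hsub : Set.Ioc a 1 ⊆ Set.Ioi r := fun x hx => hra.trans_lt hx.1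
  have hinv : IntegrableOn (fun x : ℝ => 5 ^ (-(n / 2)) * x⁻¹) (Set.Ioc a 1) := by
    rw [← intervalIntegrable_iff_integrableOn_Ioc_of_le h1.le]
    refine (intervalIntegral.intervalIntegrable_inv (f := id) (fun x hx => ?_)
      continuousOn_id).const_mul _
    rw [Set.uIcc_of_le h1.le] at hx
    exact (ha0.trans_le hx.1).ne'
  calc (5 : ℝ) ^ (-(n / 2)) * -Real.log a
      = ∫ x in Set.Ioc a 1, 5 ^ (-(n / 2)) * x⁻¹ := by
        rw [integral_const_mul, ← intervalIntegral.integral_of_le h1.le,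
          integral_inv_of_pos ha0 one_pos, one_div, Real.log_inv]
    _ ≤ ∫ r' in Set.Ioc a 1, ∫ x in Set.Ioi r', (x ^ 2 + ε ^ 2) ^ (-(n / 2)) :=
        setIntegral_mono_on hinv (hI.mono_set hsub) measurableSet_Ioc
          fun x hx => mul_inv_le_tail hn hε (hεa.trans hx.1.le) hx.2
    _ ≤ Geps n ε r :=
        setIntegral_mono_set hI
          (Filter.Eventually.of_forall fun _ => integral_nonneg fun x => by positivity)
          hsub.eventuallyLE

/-- There is a constant `C` depending only on `n > 2` such that for all `ε ∈ (0,1)`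
and all `r`, `|log F_ε(r)| ≤ C (G_ε(r) + |r| + 1)`. -/
theorem abs_log_Feps_le (n : ℝ) (hn : 2 < n) :
    ∃ C : ℝ, ∀ ε ∈ Set.Ioo (0 : ℝ) 1, ∀ r : ℝ,
      |Real.log (Feps n ε r)| ≤ C * (Geps n ε r + |r| + 1) := by
  have hc : (0 : ℝ) < 5 ^ (-(n / 2)) := by positivity
  refine ⟨n / 4 * (2 / 5 ^ (-(n / 2)) + 2), fun ε hε r => ?_⟩
  have hG := mul_neg_log_le_Geps (r := r) hn hε
  have hG0 := Geps_nonneg n ε r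
  obtain ⟨h0, h1⟩ := hε
  have hs : 0 < r ^ 2 + ε ^ 2 := by positivity
  rw [mul_comm, ← le_div_iff₀ hc] at hG
  rw [Feps, Real.log_rpow hs, abs_mul, abs_of_pos (by linarith : 0 < n / 4), mul_assoc]
  refine mul_le_mul_of_nonneg_left ?_ (by linarith)
  have hr := abs_nonneg r
  have ha : 0 < |r| + ε := by linarith
  have hupper : Real.log (r ^ 2 + ε ^ 2) ≤ 2 * |r| := by
    calc Real.log (r ^ 2 + ε ^ 2) ≤ Real.log ((|r| + 1) ^ 2) :=
          Real.log_le_log hs (by nlinarith [sq_abs r])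
      _ = 2 * Real.log (|r| + 1) := by rw [Real.log_pow]; norm_num
      _ ≤ 2 * |r| := by linarith [Real.log_le_sub_one_of_pos (by linarith : 0 < |r| + 1)]
  have hlower : 2 * Real.log (|r| + ε) - 1 ≤ Real.log (r ^ 2 + ε ^ 2) := by
    have h : Real.log ((|r| + ε) ^ 2) ≤ Real.log (2 * (r ^ 2 + ε ^ 2)) :=
      Real.log_le_log (by positivity) (by nlinarith [sq_abs r, sq_nonneg (|r| - ε)])
    rw [Real.log_pow, Real.log_mul two_ne_zero hs.ne'] at h
    push_cast at h
    linarith [Real.log_le_sub_one_of_pos (zero_lt_two (α := ℝ))]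
  have hk : 0 ≤ 2 / (5 : ℝ) ^ (-(n / 2)) := by positivity
  have hkG : 2 / (5 : ℝ) ^ (-(n / 2)) * Geps n ε r
      = 2 * (Geps n ε r / 5 ^ (-(n / 2))) := by ring
  have hkG0 := mul_nonneg hk hG0
  have hkr := mul_nonneg hk hr
  rw [abs_le]
  constructor <;> linarith
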